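/- (Uniqueness of the linear Weil representation) Suppose p ≥ 5. If ρ and ρ' are two group homomorphisms from SL(2, ZMod p) to the group of linear automorphisms of ℂ(ZMod p) which both satisfy the Egorov identity ρ(g) ∘ π(v, z) ∘ ρ(g)⁻¹ = π(g·v, z) for all g ∈ SL(2, ZMod p), v ∈ (ZMod p)², z ∈ ZMod p (and likewise for ρ'), then ρ = ρ'. -/

import Mathlib

open scoped BigOperators

noncomputable section

namespace DFTWeil

open scoped Classical

/-- Multiplication of the Heisenberg group `H = (V × V) × Z`,
`(v,z)·(v',z') = (v+v', z+z'+2⁻¹ ω(v,v'))` with `ω((t,w),(t',w')) = t w' - w t'`. -/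
def hMul {p : ℕ} (a b : (ZMod p × ZMod p) × ZMod p) : (ZMod p × ZMod p) × ZMod p :=
  (a.1 + b.1, a.2 + b.2 + (2 : ZMod p)⁻¹ * (a.1.1 * b.1.2 - a.1.2 * b.1.1))

/-- The additive character `ψ(z) = exp(2πi z/p)`. -/
def psi (p : ℕ) (z : ZMod p) : ℂ :=
  Complex.exp (2 * Real.pi * Complex.I * (z.val : ℂ) / p)

/-- The standard realization of the Heisenberg representation:
`(π((t,w),z) f)(x) = ψ(z + 2⁻¹ t w + w x) f(x+t)`. -/
def heis (p : ℕ) (h : (ZMod p × ZMod p) × ZMod p) :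
    (ZMod p → ℂ) →ₗ[ℂ] (ZMod p → ℂ) where
  toFun f x := psi p (h.2 + (2 : ZMod p)⁻¹ * h.1.1 * h.1.2 + h.1.2 * x) * f (x + h.1.1)
  map_add' f g := by funext x; simp [mul_add]
  map_smul' c f := by funext x; simp [Pi.smul_apply, smul_eq_mul]; ring

/-- The Legendre character `σ` of `ZMod p` (extended by `0` at `0`). -/
def sgm (p : ℕ) (a : ZMod p) : ℂ := if a = 0 then 0 else if IsSquare a then 1 else -1

/-- Action of a `2 × 2` matrix on a column vector `v ∈ (ZMod p)²`. -/
def matVec {p : ℕ} (m : Matrix (Fin 2) (Fin 2) (ZMod p)) (v : ZMod p × ZMod p) :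
    ZMod p × ZMod p :=
  (m 0 0 * v.1 + m 0 1 * v.2, m 1 0 * v.1 + m 1 1 * v.2)

/-- The symplectic form `ω((t,w),(t',w')) = t w' - w t'`. -/
def omg {p : ℕ} (v w : ZMod p × ZMod p) : ZMod p := v.1 * w.2 - v.2 * w.1

/-- The Cayley transform `κ(g) = (g+I)(g-I)⁻¹`. -/
def cayley {p : ℕ} (g : Matrix (Fin 2) (Fin 2) (ZMod p)) : Matrix (Fin 2) (Fin 2) (ZMod p) :=
  (g + 1) * (g - 1)⁻¹

/-- The Weil operator given by the kernel formula
`ρ(g) = p⁻¹ σ(-det(κ(g)+I)) Σ_v ψ(4⁻¹ ω(κ(g)v,v)) π(v,0)`. -/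
def weilOp (p : ℕ) [Fact p.Prime] (g : Matrix (Fin 2) (Fin 2) (ZMod p)) :
    (ZMod p → ℂ) →ₗ[ℂ] (ZMod p → ℂ) :=
  (p : ℂ)⁻¹ • sgm p (-((cayley g + 1).det)) •
    ∑ v : ZMod p × ZMod p,
      psi p ((4 : ZMod p)⁻¹ * omg (matVec (cayley g) v) v) • heis p (v, 0)

theorem psi_eq_stdAddChar (p : ℕ) [NeZero p] (z : ZMod p) : psi p z = ZMod.stdAddChar z := by
  rw [ZMod.stdAddChar_apply, ZMod.toCircle_apply, psi]

theorem psi_injective (p : ℕ) [NeZero p] : Function.Injective (psi p) := by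
  intro a b h
  rw [psi_eq_stdAddChar, psi_eq_stdAddChar] at h
  exact ZMod.injective_stdAddChar h

theorem psi_zero (p : ℕ) : psi p 0 = 1 := by
  simp [psi]

theorem heis_modulation_apply (p : ℕ) (f : ZMod p → ℂ) (x : ZMod p) :
    heis p ((0, 1), 0) f x = psi p x * f x := by
  simp [heis]

theorem heis_translation_apply (p : ℕ) (t : ZMod p) (f : ZMod p → ℂ) (x : ZMod p) :
    heis p ((t, 0), 0) f x = f (x + t) := by
  simp [heis, psi_zero]

/-- Schur's lemma for the Heisenberg representation. -/
theorem exists_eq_smul_of_commute_heis (p : ℕ) [NeZero p]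
    (T : (ZMod p → ℂ) →ₗ[ℂ] (ZMod p → ℂ))
    (hT : ∀ (v : ZMod p × ZMod p) (z : ZMod p) (f : ZMod p → ℂ),
      T (heis p (v, z) f) = heis p (v, z) (T f)) :
    ∃ c : ℂ, ∀ f, T f = c • f := by
  have off_diag (x y : ZMod p) (hxy : x ≠ y) : T (Pi.single y 1) x = 0 := by
    have hmod : heis p ((0, 1), 0) (Pi.single y 1) =
        psi p y • (Pi.single y 1 : ZMod p → ℂ) := by
      funext u
      rw [heis_modulation_apply]
      by_cases h : u = y
      · subst h; simp
      · simp [h]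
    have key := congrFun (hT (0, 1) 0 (Pi.single y 1)) x
    rw [hmod, map_smul, heis_modulation_apply, Pi.smul_apply, smul_eq_mul] at key
    by_contra h0
    exact hxy (psi_injective p (mul_right_cancel₀ h0 key)).symm
  have diag (y : ZMod p) : T (Pi.single y 1) y = T (Pi.single 0 1) 0 := by
    have htr : heis p ((y, 0), 0) (Pi.single y 1) = (Pi.single 0 1 : ZMod p → ℂ) := by
      funext u
      rw [heis_translation_apply]
      simp [Pi.single_apply]
    have key := congrFun (hT (y, 0) 0 (Pi.single y 1)) 0
    rw [htr, heis_translation_apply, zero_add] at key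
    exact key.symm
  refine ⟨T (Pi.single 0 1) 0, fun f => ?_⟩
  have hT_eq : T = T (Pi.single 0 1) 0 • LinearMap.id := by
    refine LinearMap.pi_ext' fun y => LinearMap.ext_ring ?_
    funext x
    by_cases h : x = y
    · subst h; simpa using diag x
    · simpa [h] using off_diag x y h
  exact LinearMap.congr_fun hT_eq f

open scoped commutatorElement in
/-- Two homomorphisms which agree up to central elements agree on commutators. -/
theorem commutator_le_eqLocus {G K : Type*} [Group G] [Group K] (φ φ' : G →* K)
    (h : ∀ g, (φ' g)⁻¹ * φ g ∈ Subgroup.center K) :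
    commutator G ≤ φ.eqLocus φ' := by
  rw [commutator_def, Subgroup.commutator_le]
  intro a _ b _
  change φ ⁅a, b⁆ = φ' ⁅a, b⁆
  obtain ⟨z, hz, hza⟩ : ∃ z ∈ Subgroup.center K, φ a = φ' a * z := ⟨_, h a, by group⟩
  obtain ⟨w, hw, hwb⟩ : ∃ w ∈ Subgroup.center K, φ b = φ' b * w := ⟨_, h b, by group⟩
  rw [Subgroup.mem_center_iff] at hz hw
  rw [map_commutatorElement, map_commutatorElement, hza, hwb, commutatorElement_def,
    commutatorElement_def]
  calc φ' a * z * (φ' b * w) * (φ' a * z)⁻¹ * (φ' b * w)⁻¹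
      = φ' a * (z * (φ' b * w)) * (φ' a * z)⁻¹ * (φ' b * w)⁻¹ := by group
    _ = φ' a * φ' b * (w * (φ' a)⁻¹) * w⁻¹ * (φ' b)⁻¹ := by rw [← hz]; group
    _ = φ' a * φ' b * (φ' a)⁻¹ * (φ' b)⁻¹ := by rw [← hw]; group

/-- Uniqueness of the linear Weil representation for `p ≥ 5`. -/
theorem stmt4 (p : ℕ) [Fact p.Prime] (hp : 5 ≤ p)
    (ρ ρ' : Matrix.SpecialLinearGroup (Fin 2) (ZMod p) →* ((ZMod p → ℂ) ≃ₗ[ℂ] (ZMod p → ℂ)))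
    (hρ : ∀ (g : Matrix.SpecialLinearGroup (Fin 2) (ZMod p)) (v : ZMod p × ZMod p)
      (z : ZMod p) (f : ZMod p → ℂ),
      (ρ g) (heis p (v, z) ((ρ g).symm f)) =
        heis p (matVec (g : Matrix (Fin 2) (Fin 2) (ZMod p)) v, z) f)
    (hρ' : ∀ (g : Matrix.SpecialLinearGroup (Fin 2) (ZMod p)) (v : ZMod p × ZMod p)
      (z : ZMod p) (f : ZMod p → ℂ),
      (ρ' g) (heis p (v, z) ((ρ' g).symm f)) =
        heis p (matVec (g : Matrix (Fin 2) (Fin 2) (ZMod p)) v, z) f) :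
    ρ = ρ' := by
  have hcomm : commutator (Matrix.SpecialLinearGroup (Fin 2) (ZMod p)) = ⊤ := by
    have natCast_ne_zero (n : ℕ) (hn : 0 < n) (hnp : n < p) : (n : ZMod p) ≠ 0 := fun h =>
      Nat.not_dvd_of_pos_of_lt hn hnp ((ZMod.natCast_eq_zero_iff n p).mp h)
    refine Matrix.SL2.commutator_eq_top (a := 2) (natCast_ne_zero 2 (by omega) (by omega)) ?_
    intro h
    refine natCast_ne_zero 3 (by omega) (by omega) ?_
    push_cast
    linear_combination h
  have hcenter (g) : (ρ' g)⁻¹ * ρ g ∈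
      Subgroup.center ((ZMod p → ℂ) ≃ₗ[ℂ] (ZMod p → ℂ)) := by
    obtain ⟨c, hc⟩ := exists_eq_smul_of_commute_heis p
      ((ρ g).trans (ρ' g).symm : (ZMod p → ℂ) ≃ₗ[ℂ] (ZMod p → ℂ)).toLinearMap (by
        intro v z f
        have h := hρ g v z (ρ g f)
        rw [LinearEquiv.symm_apply_apply, ← hρ' g v z (ρ g f)] at h
        change (ρ' g).symm (ρ g _) = _
        rw [h, LinearEquiv.symm_apply_apply]
        rfl)
    have hsmul (f) : ((ρ' g)⁻¹ * ρ g) f = c • f := hc f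
    rw [Subgroup.mem_center_iff]
    intro k
    ext1 f
    change k (((ρ' g)⁻¹ * ρ g) f) = ((ρ' g)⁻¹ * ρ g) (k f)
    rw [hsmul, hsmul, map_smul]
  ext1 g
  have hg : g ∈ commutator (Matrix.SpecialLinearGroup (Fin 2) (ZMod p)) :=
    hcomm ▸ Subgroup.mem_top g
  exact commutator_le_eqLocus ρ ρ' hcenter hg

end DFTWeil
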